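/- For every λ > 0 and every real z with 0 < z < 1/(λ + √2), the moment generating series of ν_λ converges and satisfies Σ_{n=0}^∞ (∫_ℝ x^n dν_λ(x)) · z^n = 1 / (λz + √((1 − λz)² − 2z²)), where √ is the real square root. -/

import Mathlib

open MeasureTheory

-- Absolutely continuous part of `ν_λ`: density
-- `x ↦ √(2 − (x − λ)²)/(π(λ² + 2 − (x − λ)²))` on `(λ − √2, λ + √2)`, `0` elsewhere.
open Classical in
noncomputable def nuAC (lam : ℝ) : Measure ℝ :=
  volume.withDensity fun x =>
    ENNReal.ofReal (if x ∈ Set.Ioo (lam - Real.sqrt 2) (lam + Real.sqrt 2) then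
      Real.sqrt (2 - (x - lam) ^ 2) / (Real.pi * (lam ^ 2 + 2 - (x - lam) ^ 2)) else 0)

-- `ν_λ = (λ/√(λ²+2))·δ_{λ−√(λ²+2)} + ν^{ac}_λ`.
noncomputable def nuMeas (lam : ℝ) : Measure ℝ :=
  (ENNReal.ofReal (lam / Real.sqrt (lam ^ 2 + 2))) •
      Measure.dirac (lam - Real.sqrt (lam ^ 2 + 2)) + nuAC lam

open Filter Topology

/-- An antiderivative of `2 / ((λ² (1 + t²) + 2) (μ² (1 + t²) + 2))` with its limits at `±∞`. -/
theorem exists_antideriv_rational {l m : ℝ} (hl : 0 < l) (hm : 0 < m) :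
    ∃ H : ℝ → ℝ,
      (∀ t, HasDerivAt H (2 / ((l ^ 2 * (1 + t ^ 2) + 2) * (m ^ 2 * (1 + t ^ 2) + 2))) t) ∧
      Tendsto H atTop (𝓝 (Real.pi / (√(l ^ 2 + 2) * √(m ^ 2 + 2) *
        (√(l ^ 2 + 2) * m + √(m ^ 2 + 2) * l)))) ∧
      Tendsto H atBot (𝓝 (-(Real.pi / (√(l ^ 2 + 2) * √(m ^ 2 + 2) *
        (√(l ^ 2 + 2) * m + √(m ^ 2 + 2) * l))))) := by
  obtain ⟨R, hR, hR2⟩ : ∃ R, 0 < R ∧ R ^ 2 = l ^ 2 + 2 :=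
    ⟨√(l ^ 2 + 2), by positivity, Real.sq_sqrt (by positivity)⟩
  obtain ⟨c, hc, hc2⟩ : ∃ c, 0 < c ∧ c ^ 2 = m ^ 2 + 2 :=
    ⟨√(m ^ 2 + 2), by positivity, Real.sq_sqrt (by positivity)⟩
  rw [← hR2, ← hc2, Real.sqrt_sq hR.le, Real.sqrt_sq hc.le]
  have hT : ∀ k : ℝ, 0 < k → Tendsto (fun t : ℝ => Real.arctan (k * t)) atTop
      (𝓝 (Real.pi / 2)) := fun k hk =>
    (tendsto_nhds_of_tendsto_nhdsWithin Real.tendsto_arctan_atTop).comp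
      (tendsto_id.const_mul_atTop hk)
  have hB : ∀ k : ℝ, 0 < k → Tendsto (fun t : ℝ => Real.arctan (k * t)) atBot
      (𝓝 (-(Real.pi / 2))) := fun k hk =>
    (tendsto_nhds_of_tendsto_nhdsWithin Real.tendsto_arctan_atBot).comp
      (tendsto_id.const_mul_atBot hk)
  have hD : ∀ k t : ℝ, HasDerivAt (fun t : ℝ => Real.arctan (k * t))
      (1 / (1 + (k * t) ^ 2) * k) t := fun k t => by
    simpa using ((hasDerivAt_id t).const_mul k).arctan
  by_cases h : l = m
  · subst h
    have hcR : c = R := by nlinarith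
    subst hcR
    have hinv : ∀ f : Filter ℝ, Tendsto (fun t : ℝ => t⁻¹) f (𝓝 0) → (∀ᶠ t in f, t ≠ 0) →
        Tendsto (fun t : ℝ => t / (c ^ 2 * (c ^ 2 + l ^ 2 * t ^ 2))) f (𝓝 0) := by
      intro f hf hne
      have : Tendsto (fun t : ℝ => t⁻¹ / (c ^ 2 * (c ^ 2 * (t⁻¹) ^ 2 + l ^ 2))) f
          (𝓝 (0 / (c ^ 2 * (c ^ 2 * 0 ^ 2 + l ^ 2)))) :=
        hf.div ((((hf.pow 2).const_mul _).add_const _).const_mul _) (by positivity)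
      rw [zero_div] at this
      refine this.congr' ?_
      filter_upwards [hne] with t ht
      have : 0 < c ^ 2 + l ^ 2 * t ^ 2 := by positivity
      field_simp
    refine ⟨fun t => t / (c ^ 2 * (c ^ 2 + l ^ 2 * t ^ 2)) +
      1 / (l * c ^ 3) * Real.arctan (l / c * t), fun t => ?_, ?_, ?_⟩
    · have h1 : HasDerivAt (fun t : ℝ => c ^ 2 * (c ^ 2 + l ^ 2 * t ^ 2))
          (c ^ 2 * (l ^ 2 * (2 * t))) t := by
        simpa using (((hasDerivAt_pow 2 t).const_mul (l ^ 2)).const_add (c ^ 2)).const_mul (c ^ 2)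
      refine (((hasDerivAt_id t).div h1 (by positivity)).add
        ((hD (l / c) t).const_mul (1 / (l * c ^ 3)))).congr_deriv ?_
      rw [show l ^ 2 * (1 + t ^ 2) + 2 = c ^ 2 + l ^ 2 * t ^ 2 by rw [hc2]; ring]
      have h2 : 0 < c ^ 2 + l ^ 2 * t ^ 2 := by positivity
      rw [show 1 + (l / c * t) ^ 2 = (c ^ 2 + l ^ 2 * t ^ 2) / c ^ 2 by field_simp]
      simp only [id]
      field_simp
      ring
    · convert (hinv _ tendsto_inv_atTop_zero (eventually_ne_atTop 0)).add
        ((hT (l / c) (by positivity)).const_mul (1 / (l * c ^ 3))) using 2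
      field_simp
      ring
    · convert (hinv _ tendsto_inv_atBot_zero (eventually_ne_atBot 0)).add
        ((hB (l / c) (by positivity)).const_mul (1 / (l * c ^ 3))) using 2
      field_simp
      ring
  · have hlm : l ^ 2 - m ^ 2 ≠ 0 := fun h0 => h (by nlinarith)
    have hval : (l / R - m / c) / (l ^ 2 - m ^ 2) = 2 / (R * c * (R * m + c * l)) := by
      have : 0 < R * m + c * l := by positivity
      field_simp
      linear_combination l ^ 2 * hc2 - m ^ 2 * hR2
    refine ⟨fun t => (l / R * Real.arctan (l / R * t) - m / c * Real.arctan (m / c * t)) /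
      (l ^ 2 - m ^ 2), fun t => ?_, ?_, ?_⟩
    · refine ((((hD (l / R) t).const_mul (l / R)).sub
        ((hD (m / c) t).const_mul (m / c))).div_const (l ^ 2 - m ^ 2)).congr_deriv ?_
      rw [show l ^ 2 * (1 + t ^ 2) + 2 = R ^ 2 + l ^ 2 * t ^ 2 by rw [hR2]; ring,
        show m ^ 2 * (1 + t ^ 2) + 2 = c ^ 2 + m ^ 2 * t ^ 2 by rw [hc2]; ring,
        show 1 + (l / R * t) ^ 2 = (R ^ 2 + l ^ 2 * t ^ 2) / R ^ 2 by field_simp,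
        show 1 + (m / c * t) ^ 2 = (c ^ 2 + m ^ 2 * t ^ 2) / c ^ 2 by field_simp]
      have h1 : 0 < R ^ 2 + l ^ 2 * t ^ 2 := by positivity
      have h2 : 0 < c ^ 2 + m ^ 2 * t ^ 2 := by positivity
      field_simp
      linear_combination l ^ 2 * hc2 - m ^ 2 * hR2
    · convert (((hT (l / R) (by positivity)).const_mul (l / R)).sub
        ((hT (m / c) (by positivity)).const_mul (m / c))).div_const (l ^ 2 - m ^ 2) using 2
      linear_combination (-Real.pi / 2) * hval
    · convert (((hB (l / R) (by positivity)).const_mul (l / R)).sub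
        ((hB (m / c) (by positivity)).const_mul (m / c))).div_const (l ^ 2 - m ^ 2) using 2
      linear_combination (Real.pi / 2) * hval

theorem two_sub_sq_pos_of_mem_Ioo {u : ℝ} (hu : u ∈ Set.Ioo (-√2) √2) : 0 < 2 - u ^ 2 := by
  have := Real.sq_sqrt (show (0 : ℝ) ≤ 2 by norm_num)
  nlinarith [hu.1, hu.2]

theorem integral_sqrt_div_mul {l m : ℝ} (hl : 0 < l) (hm : 0 < m) :
    ∫ u in (-√2)..√2, √(2 - u ^ 2) / ((l ^ 2 + √(2 - u ^ 2) ^ 2) * (m ^ 2 + √(2 - u ^ 2) ^ 2)) =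
      2 * Real.pi / (√(l ^ 2 + 2) * √(m ^ 2 + 2) *
        (√(l ^ 2 + 2) * m + √(m ^ 2 + 2) * l)) := by
  obtain ⟨H, hH, hT, hB⟩ := exists_antideriv_rational hl hm
  have hs2 : (0 : ℝ) < √2 := by positivity
  have hcont : Continuous fun u : ℝ => √(2 - u ^ 2) := by fun_prop
  have hpos : ∀ {u : ℝ}, u ∈ Set.Ioo (-√2) √2 → 0 < √(2 - u ^ 2) := fun hu =>
    Real.sqrt_pos.2 (two_sub_sq_pos_of_mem_Ioo hu)
  have hmem : ∀ (a : ℝ) (s : Set ℝ), a ^ 2 = 2 → (Set.Ioo (-√2) √2 ∈ 𝓝[s] a) →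
      Tendsto (fun u : ℝ => (√(2 - u ^ 2))⁻¹) (𝓝[s] a) atTop := by
    intro a s ha hs
    refine tendsto_inv_nhdsGT_zero.comp (tendsto_nhdsWithin_iff.2 ⟨?_, ?_⟩)
    · have := (hcont.tendsto a).mono_left (nhdsWithin_le_nhds (s := s))
      simpa [ha] using this
    · filter_upwards [hs] with u hu using hpos hu
  have hbot : Tendsto (fun u : ℝ => u * (√(2 - u ^ 2))⁻¹) (𝓝[>] (-√2)) atBot :=
    Tendsto.neg_mul_atTop (C := -√2) (by linarith)
      (tendsto_id.mono_left nhdsWithin_le_nhds)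
      (hmem _ _ (by simp) (Ioo_mem_nhdsGT (by linarith)))
  have htop : Tendsto (fun u : ℝ => u * (√(2 - u ^ 2))⁻¹) (𝓝[<] √2) atTop :=
    Tendsto.pos_mul_atTop (C := √2) hs2
      (tendsto_id.mono_left nhdsWithin_le_nhds)
      (hmem _ _ (by simp) (Ioo_mem_nhdsLT (by linarith)))
  have hint : IntervalIntegrable (fun u => √(2 - u ^ 2) /
      ((l ^ 2 + √(2 - u ^ 2) ^ 2) * (m ^ 2 + √(2 - u ^ 2) ^ 2))) volume (-√2) √2 := by
    refine Continuous.intervalIntegrable (Continuous.div hcont (by fun_prop) fun u => ?_) _ _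
    positivity
  have hderiv : ∀ u ∈ Set.Ioo (-√2) √2, HasDerivAt (fun u => H (u * (√(2 - u ^ 2))⁻¹))
      (√(2 - u ^ 2) / ((l ^ 2 + √(2 - u ^ 2) ^ 2) * (m ^ 2 + √(2 - u ^ 2) ^ 2))) u := by
    intro u hu
    have hs := hpos hu
    have hsu := Real.sq_sqrt (two_sub_sq_pos_of_mem_Ioo hu).le
    have h1 : HasDerivAt (fun u : ℝ => √(2 - u ^ 2)) (-(2 * u) / (2 * √(2 - u ^ 2))) u := by
      simpa using ((hasDerivAt_pow 2 u).const_sub 2).sqrt (two_sub_sq_pos_of_mem_Ioo hu).ne'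
    have h2 : HasDerivAt (fun u : ℝ => u * (√(2 - u ^ 2))⁻¹) _ u :=
      (hasDerivAt_id u).mul (h1.inv hs.ne')
    refine ((hH _).comp u h2).congr_deriv ?_
    simp only [id]
    set s := √(2 - u ^ 2)
    have e : ∀ k : ℝ, k ^ 2 * (1 + (u * s⁻¹) ^ 2) + 2 = 2 * (k ^ 2 + s ^ 2) / s ^ 2 := by
      intro k
      field_simp
      linear_combination k ^ 2 * hsu
    rw [e, e]
    field_simp
    linear_combination hsu
  rw [intervalIntegral.integral_eq_sub_of_hasDerivAt_of_tendsto (by linarith) hderiv hint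
    (hB.comp hbot) (hT.comp htop)]
  ring

theorem integral_sqrt_div_mul_inv_sub {l m : ℝ} (hl : 0 < l) (hm : 0 < m) :
    ∫ u in (-√2)..√2, √(2 - u ^ 2) / (l ^ 2 + √(2 - u ^ 2) ^ 2) * (√(m ^ 2 + 2) - u)⁻¹ =
      2 * Real.pi / (√(l ^ 2 + 2) * (√(l ^ 2 + 2) * m + √(m ^ 2 + 2) * l)) := by
  obtain ⟨c, hc, hc2, hcd⟩ : ∃ c, 0 < c ∧ c ^ 2 = m ^ 2 + 2 ∧ √(m ^ 2 + 2) = c :=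
    ⟨√(m ^ 2 + 2), by positivity, Real.sq_sqrt (by positivity), rfl⟩
  have hmain := integral_sqrt_div_mul hl hm
  rw [hcd] at hmain ⊢
  have hs2 : (0 : ℝ) < √2 := by positivity
  have hsc : √2 < c := by
    rw [← hcd]; exact Real.sqrt_lt_sqrt (by norm_num) (by nlinarith)
  have hle : -√2 ≤ √2 := by linarith
  set f : ℝ → ℝ := fun u => √(2 - u ^ 2) / (l ^ 2 + √(2 - u ^ 2) ^ 2) * (c - u)⁻¹ with hf
  have hfi : ∀ ε : ℝ, ε ^ 2 = 1 →
      IntervalIntegrable (fun u => f (ε * u)) volume (-√2) √2 := by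
    intro ε hε
    refine ContinuousOn.intervalIntegrable ?_
    rw [Set.uIcc_of_le hle]
    refine ContinuousOn.mul (Continuous.continuousOn (Continuous.div (by fun_prop) (by fun_prop)
      fun u => by positivity)) (ContinuousOn.inv₀ (by fun_prop) fun u hu => ?_)
    have : |ε * u| ≤ √2 := by
      rw [abs_mul, show |ε| = 1 by rw [← Real.sqrt_sq_eq_abs, hε, Real.sqrt_one], one_mul]
      exact abs_le.2 hu
    linarith [le_abs_self (ε * u)]
  have h1 : ∫ u in (-√2)..√2, f (-u) = ∫ u in (-√2)..√2, f u := by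
    rw [intervalIntegral.integral_comp_neg, neg_neg]
  have h2 : ∫ u in (-√2)..√2, (f u + f (-u)) = 2 * ∫ u in (-√2)..√2, f u := by
    rw [intervalIntegral.integral_add (by simpa using hfi 1 (by norm_num))
      (by simpa using hfi (-1) (by norm_num)), h1]
    ring
  have h3 : ∫ u in (-√2)..√2, (f u + f (-u)) = ∫ u in (-√2)..√2, (2 * c) *
      (√(2 - u ^ 2) / ((l ^ 2 + √(2 - u ^ 2) ^ 2) * (m ^ 2 + √(2 - u ^ 2) ^ 2))) := by
    refine intervalIntegral.integral_congr fun u hu => ?_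
    rw [Set.uIcc_of_le hle] at hu
    have h0 : 0 ≤ 2 - u ^ 2 := by
      have := Real.sq_sqrt (show (0 : ℝ) ≤ 2 by norm_num)
      nlinarith [hu.1, hu.2]
    have ha : 0 < c - u := by linarith [hu.2]
    have hb : 0 < c + u := by linarith [hu.1]
    have hm2 : m ^ 2 + √(2 - u ^ 2) ^ 2 = (c - u) * (c + u) := by
      rw [Real.sq_sqrt h0]; linear_combination -hc2
    simp only [hf, neg_sq, sub_neg_eq_add]
    rw [hm2]
    have : 0 < l ^ 2 + √(2 - u ^ 2) ^ 2 := by positivity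
    field_simp
    ring
  rw [h3, intervalIntegral.integral_const_mul, hmain] at h2
  rw [show ∫ u in (-√2)..√2, f u = (2 * ∫ u in (-√2)..√2, f u) / 2 by ring, ← h2]
  have : 0 < √(l ^ 2 + 2) := by positivity
  field_simp

/-- The density of the absolutely continuous part of `ν_λ`, in a form continuous on `ℝ`. -/
noncomputable def nuDensity (lam x : ℝ) : ℝ :=
  √(2 - (x - lam) ^ 2) / (Real.pi * (lam ^ 2 + √(2 - (x - lam) ^ 2) ^ 2))

theorem continuous_nuDensity {lam : ℝ} (hlam : 0 < lam) : Continuous (nuDensity lam) := by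
  unfold nuDensity
  refine Continuous.div (by fun_prop) (by fun_prop) fun x => ?_
  have := Real.pi_pos
  positivity

theorem nuDensity_nonneg (lam x : ℝ) : 0 ≤ nuDensity lam x := by
  have := Real.pi_pos
  unfold nuDensity
  positivity

theorem nuAC_eq (lam : ℝ) : nuAC lam =
    (volume.restrict (Set.Ioc (lam - √2) (lam + √2))).withDensity
      fun x => ENNReal.ofReal (nuDensity lam x) := by
  rw [nuAC, Measure.restrict_congr_set Ioo_ae_eq_Ioc.symm,
    ← withDensity_indicator measurableSet_Ioo]
  congr 1
  ext x
  by_cases hx : x ∈ Set.Ioo (lam - √2) (lam + √2)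
  · have h : 0 < 2 - (x - lam) ^ 2 :=
      two_sub_sq_pos_of_mem_Ioo ⟨by linarith [hx.1], by linarith [hx.2]⟩
    rw [if_pos hx, Set.indicator_of_mem hx, nuDensity, Real.sq_sqrt h.le]
    ring_nf
  · rw [if_neg hx, Set.indicator_of_notMem hx, ENNReal.ofReal_zero]

theorem isFiniteMeasure_nuAC {lam : ℝ} (hlam : 0 < lam) : IsFiniteMeasure (nuAC lam) := by
  rw [nuAC_eq]
  exact isFiniteMeasure_withDensity_ofReal
    ((continuous_nuDensity hlam).integrableOn_Ioc.hasFiniteIntegral)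

theorem integral_nuAC {lam : ℝ} (hlam : 0 < lam) (f : ℝ → ℝ) :
    ∫ x, f x ∂(nuAC lam) = ∫ u in (-√2)..√2, nuDensity lam (u + lam) * f (u + lam) := by
  rw [nuAC_eq, integral_withDensity_eq_integral_toReal_smul
    (continuous_nuDensity hlam).measurable.ennreal_ofReal (by simp),
    intervalIntegral.integral_comp_add_right (fun x => nuDensity lam x * f x),
    intervalIntegral.integral_of_le (by linarith [Real.sqrt_nonneg 2]),
    neg_add_eq_sub, add_comm √2 lam]
  simp only [ENNReal.toReal_ofReal (nuDensity_nonneg lam _), smul_eq_mul]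

theorem ae_nuAC_mem (lam : ℝ) : ∀ᵐ x ∂(nuAC lam), x ∈ Set.Ioc (lam - √2) (lam + √2) := by
  rw [nuAC_eq]
  exact (withDensity_absolutelyContinuous _ _).ae_le (ae_restrict_mem measurableSet_Ioc)

theorem isFiniteMeasure_nuMeas {lam : ℝ} (hlam : 0 < lam) : IsFiniteMeasure (nuMeas lam) := by
  have := isFiniteMeasure_nuAC hlam
  have := Measure.smul_finite (Measure.dirac (lam - √(lam ^ 2 + 2)))
    (c := ENNReal.ofReal (lam / √(lam ^ 2 + 2))) ENNReal.ofReal_ne_top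
  unfold nuMeas
  infer_instance

theorem ae_nuMeas_abs_le {lam : ℝ} (hlam : 0 < lam) :
    ∀ᵐ x ∂(nuMeas lam), |x| ≤ lam + √2 := by
  have h2 := Real.sqrt_nonneg 2
  rw [nuMeas, ae_add_measure_iff]
  constructor
  · refine Measure.ae_smul_measure ?_ _
    rw [ae_dirac_iff (measurableSet_le (by fun_prop) (by fun_prop))]
    have h : √(lam ^ 2 + 2) ≤ lam + √2 := by
      rw [Real.sqrt_le_left (by positivity)]
      nlinarith [Real.sq_sqrt (show (0 : ℝ) ≤ 2 by norm_num), mul_nonneg hlam.le h2]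
    rw [abs_le]
    constructor <;> linarith [Real.sqrt_nonneg (lam ^ 2 + 2)]
  · filter_upwards [ae_nuAC_mem lam] with x hx
    rw [abs_le]
    constructor <;> linarith [hx.1, hx.2]

theorem hasSum_integral_pow_mul_pow {μ : Measure ℝ} [IsFiniteMeasure μ] {r z : ℝ}
    (hμ : ∀ᵐ x ∂μ, |x| ≤ r) (hr : 0 ≤ r) (hz : |z| * r < 1) :
    HasSum (fun n : ℕ => (∫ x, x ^ n ∂μ) * z ^ n) (∫ x, (1 - x * z)⁻¹ ∂μ) := by
  simp only [← integral_mul_const, ← mul_pow]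
  have hb : ∀ᵐ x ∂μ, |x * z| ≤ |z| * r := by
    filter_upwards [hμ] with x hx
    rw [abs_mul, mul_comm]
    gcongr
  refine hasSum_integral_of_dominated_convergence (fun n _ => (|z| * r) ^ n)
    (fun n => by fun_prop) (fun n => ?_) (ae_of_all _ fun _ => ?_) (integrable_const _) ?_
  · filter_upwards [hb] with x hx
    rw [norm_pow, Real.norm_eq_abs]
    gcongr
  · exact summable_geometric_of_lt_one (by positivity) hz
  · filter_upwards [hb] with x hx
    exact hasSum_geometric_of_abs_lt_one (hx.trans_lt hz)

theorem integral_inv_sub_nuAC {lam m : ℝ} (hlam : 0 < lam) (hm : 0 < m) :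
    ∫ x, (√(m ^ 2 + 2) + lam - x)⁻¹ ∂(nuAC lam) =
      2 / (√(lam ^ 2 + 2) * (√(lam ^ 2 + 2) * m + √(m ^ 2 + 2) * lam)) := by
  rw [integral_nuAC hlam]
  have h : ∀ u : ℝ, nuDensity lam (u + lam) * (√(m ^ 2 + 2) + lam - (u + lam))⁻¹ =
      Real.pi⁻¹ * (√(2 - u ^ 2) / (lam ^ 2 + √(2 - u ^ 2) ^ 2) * (√(m ^ 2 + 2) - u)⁻¹) := by
    intro u
    rw [nuDensity, add_sub_cancel_right, add_sub_add_right_eq_sub, mul_comm Real.pi, ← div_div,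
      div_eq_mul_inv _ Real.pi]
    ring
  simp only [h]
  rw [intervalIntegral.integral_const_mul, integral_sqrt_div_mul_inv_sub hlam hm]
  have := Real.pi_ne_zero
  field_simp

theorem integral_inv_sub_nuMeas {lam m : ℝ} (hlam : 0 < lam) (hm : 0 < m) :
    ∫ x, (√(m ^ 2 + 2) + lam - x)⁻¹ ∂(nuMeas lam) = (lam + m)⁻¹ := by
  have hac := integral_inv_sub_nuAC hlam hm
  have hpos : 0 < 2 / (√(lam ^ 2 + 2) * (√(lam ^ 2 + 2) * m + √(m ^ 2 + 2) * lam)) := by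
    positivity
  rw [nuMeas, integral_add_measure (.smul_measure (integrable_dirac (by simp))
      ENNReal.ofReal_ne_top) (not_imp_comm.1 integral_undef (hac ▸ hpos.ne')),
    integral_smul_measure, integral_dirac, hac, ENNReal.toReal_ofReal (by positivity), smul_eq_mul]
  obtain ⟨R, hR, hR2, hRd⟩ : ∃ R, 0 < R ∧ R ^ 2 = lam ^ 2 + 2 ∧ √(lam ^ 2 + 2) = R :=
    ⟨√(lam ^ 2 + 2), by positivity, Real.sq_sqrt (by positivity), rfl⟩
  obtain ⟨c, hc, hc2, hcd⟩ : ∃ c, 0 < c ∧ c ^ 2 = m ^ 2 + 2 ∧ √(m ^ 2 + 2) = c :=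
    ⟨√(m ^ 2 + 2), by positivity, Real.sq_sqrt (by positivity), rfl⟩
  rw [hRd, hcd, show c + lam - (lam - R) = c + R by ring]
  field_simp
  linear_combination -(c * (lam + m) + R * m) * hR2 - R * lam * hc2

theorem stmt17 (lam : ℝ) (hlam : 0 < lam) (z : ℝ) (hz0 : 0 < z)
    (hz1 : z < 1 / (lam + Real.sqrt 2)) :
    HasSum (fun n : ℕ => (∫ x, x ^ n ∂(nuMeas lam)) * z ^ n)
      (1 / (lam * z + Real.sqrt ((1 - lam * z) ^ 2 - 2 * z ^ 2))) := by
  have := isFiniteMeasure_nuMeas hlam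
  have hz : z * (lam + √2) < 1 := (lt_div_iff₀ (by positivity)).1 hz1
  have hs := hasSum_integral_pow_mul_pow (z := z) (ae_nuMeas_abs_le hlam) (by positivity)
    (by rwa [abs_of_pos hz0])
  have h2 := Real.sq_sqrt (show (0 : ℝ) ≤ 2 by norm_num)
  have hd : 0 < (1 - lam * z) ^ 2 - 2 * z ^ 2 := by
    have h1 : 0 < 1 - lam * z - √2 * z := by linarith
    have h3 : 0 < 1 - lam * z + √2 * z := by nlinarith [Real.sqrt_nonneg 2]
    nlinarith [mul_pos h1 h3]
  set D := √((1 - lam * z) ^ 2 - 2 * z ^ 2) with hD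
  have hD0 : 0 < D := Real.sqrt_pos.2 hd
  have hD2 : D ^ 2 = (1 - lam * z) ^ 2 - 2 * z ^ 2 := Real.sq_sqrt hd.le
  have hc : √((D / z) ^ 2 + 2) = (1 - lam * z) / z := by
    have : 0 < 1 - lam * z := by nlinarith [Real.sqrt_nonneg 2]
    rw [Real.sqrt_eq_iff_eq_sq (by positivity) (by positivity), div_pow, hD2]
    field_simp
    ring
  have hmain := integral_inv_sub_nuMeas hlam (div_pos hD0 hz0)
  rw [hc] at hmain
  convert hs using 1
  have h : ∀ x : ℝ, (1 - x * z)⁻¹ = z⁻¹ * ((1 - lam * z) / z + lam - x)⁻¹ := by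
    intro x
    rw [← mul_inv]
    congr 1
    field_simp
    ring
  simp only [h]
  rw [integral_const_mul, hmain, ← mul_inv, one_div]
  congr 1
  field_simp
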